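/- Let N be a semi-binary network on n leaves with reticulation number r, and let P be a cherry decomposition of the bulged version B(N) of N. Then P contains exactly n-1 cherry shapes and exactly r reticulated cherry shapes. -/

import Mathlib

open scoped Classical

noncomputable section

namespace PhyloNet

/-- A directed multigraph on vertex set `ℕ`, given by its multiset of arcs.
Phylogenetic networks are the simple such graphs satisfying `IsNetwork`;
bulged versions are genuinely multigraphs. -/
abbrev Graph := Multiset (ℕ × ℕ)

/-- The vertices of a multigraph: all endpoints of arcs. -/
def verts (M : Graph) : Finset ℕ :=
  M.toFinset.image Prod.fst ∪ M.toFinset.image Prod.snd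

/-- Indegree of a vertex (counting parallel arcs with multiplicity). -/
def indeg (M : Graph) (v : ℕ) : ℕ := Multiset.card (M.filter (fun e => e.2 = v))

/-- Outdegree of a vertex (counting parallel arcs with multiplicity). -/
def outdeg (M : Graph) (v : ℕ) : ℕ := Multiset.card (M.filter (fun e => e.1 = v))

def adj (M : Graph) (u v : ℕ) : Prop := (u, v) ∈ M

/-- A multigraph is acyclic if no vertex reaches itself by a nonempty directed walk. -/
def Acyclic (M : Graph) : Prop := ∀ v : ℕ, ¬ Relation.TransGen (adj M) v v

/-- No parallel arcs. -/
def Simple (M : Graph) : Prop := ∀ e : ℕ × ℕ, M.count e ≤ 1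

/-- The root: the unique vertex of indegree 0 and outdegree 1. -/
def IsRoot (M : Graph) (v : ℕ) : Prop := v ∈ verts M ∧ indeg M v = 0 ∧ outdeg M v = 1

/-- A leaf: a vertex of indegree 1 and outdegree 0. -/
def IsLeaf (M : Graph) (v : ℕ) : Prop := v ∈ verts M ∧ indeg M v = 1 ∧ outdeg M v = 0

/-- A tree vertex: indegree 1 and outdegree at least 2. -/
def IsTreeVertex (M : Graph) (v : ℕ) : Prop := v ∈ verts M ∧ indeg M v = 1 ∧ 2 ≤ outdeg M v

/-- A reticulation: indegree at least 2 and outdegree 1. -/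
def IsRetic (M : Graph) (v : ℕ) : Prop := v ∈ verts M ∧ 2 ≤ indeg M v ∧ outdeg M v = 1

/-- A (phylogenetic) network: a simple DAG with a unique root (indegree 0, outdegree 1),
in which every other vertex is a leaf (indegree 1, outdegree 0), a tree vertex
(indegree 1, outdegree ≥ 2) or a reticulation (indegree ≥ 2, outdegree 1).
The leaves are regarded as labelled by themselves (the label set is the leaf set). -/
def IsNetwork (M : Graph) : Prop :=
  Simple M ∧ Acyclic M ∧ (∃! v, IsRoot M v) ∧
    ∀ v ∈ verts M, IsRoot M v ∨ IsLeaf M v ∨ IsTreeVertex M v ∨ IsRetic M v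

/-- The set of leaves of a multigraph. -/
def leaves (M : Graph) : Finset ℕ :=
  (verts M).filter (fun v => indeg M v = 1 ∧ outdeg M v = 0)

/-- A network is a tree when it has no reticulations. -/
def IsTree (M : Graph) : Prop := IsNetwork M ∧ ∀ v : ℕ, ¬ IsRetic M v

/-- Binary: all vertices have total degree at most 3. -/
def IsBinary (M : Graph) : Prop := ∀ v ∈ verts M, indeg M v + outdeg M v ≤ 3

/-- Semi-binary: all tree vertices have total degree at most 3. -/
def IsSemiBinary (M : Graph) : Prop :=
  ∀ v : ℕ, IsTreeVertex M v → indeg M v + outdeg M v ≤ 3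

/-- The reticulation number: total number of incoming arcs of reticulations minus
the number of reticulations. -/
def reticNumber (M : Graph) : ℕ :=
  ∑ v ∈ (verts M).filter (fun v => 2 ≤ indeg M v), (indeg M v - 1)

/-- The bulged version `B(N)`: replace the outgoing edge of each reticulation of
indegree `k` by `k-1` parallel copies. -/
def bulged (M : Graph) : Graph :=
  M.bind (fun e =>
    Multiset.replicate
      (if 2 ≤ indeg M e.1 ∧ outdeg M e.1 = 1 then indeg M e.1 - 1 else 1) e)

/-- A cherry shape (on distinct vertices `x,y,p` with edges `px, py`) or a
reticulated cherry shape (on distinct vertices `x,y,p_x,p_y` with edges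
`p_x x, p_y p_x, p_y y`, `p_x` a reticulation). -/
inductive Shape : Type where
  | cherry (x y p : ℕ) : Shape
  | retic (x y px py : ℕ) : Shape
deriving DecidableEq

namespace Shape

/-- The edges of a shape. -/
def edges : Shape → Finset (ℕ × ℕ)
  | cherry x y p => {(p, x), (p, y)}
  | retic x y px py => {(px, x), (py, px), (py, y)}

/-- The endpoints of a shape. -/
def endpoints : Shape → Finset ℕ
  | cherry x y _ => {x, y}
  | retic x y _ _ => {x, y}

/-- The internal vertices of a shape. -/
def internals : Shape → Finset ℕ
  | cherry _ _ p => {p}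
  | retic _ _ px py => {px, py}

/-- The middle edge of a reticulated cherry shape. -/
def middleEdge : Shape → Option (ℕ × ℕ)
  | cherry _ _ _ => none
  | retic _ _ px py => some (py, px)

def isCherry : Shape → Bool
  | cherry _ _ _ => true
  | retic _ _ _ _ => false

/-- Validity of a shape as a subgraph of the multigraph `M`: the vertices are
distinct, the edges are present, and the internal reticulation of a reticulated
cherry shape is a reticulation of `M` (indegree ≥ 2 and outdegree ≥ 1). -/
def valid (M : Graph) : Shape → Prop
  | cherry x y p => x ≠ y ∧ x ≠ p ∧ y ≠ p ∧ (p, x) ∈ M ∧ (p, y) ∈ M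
  | retic x y px py =>
      x ≠ y ∧ x ≠ px ∧ x ≠ py ∧ y ≠ px ∧ y ≠ py ∧ px ≠ py ∧
      (px, x) ∈ M ∧ (py, px) ∈ M ∧ (py, y) ∈ M ∧
      2 ≤ indeg M px ∧ 1 ≤ outdeg M px

end Shape

/-- The number of shapes of `P` covering the arc `e`. -/
def covers (P : Finset Shape) (e : ℕ × ℕ) : ℕ :=
  (P.filter (fun A => e ∈ A.edges)).card

/-- A cherry cover of the multigraph `M` with root `r`: a set of valid shapes such
that every arc except the root arc is covered at least once, every outgoing arc of
a reticulation is covered exactly once (so, counted over parallel copies, exactly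
as often as its multiplicity), and every arc covered as the middle edge of a
reticulated cherry shape is covered exactly once. -/
def IsCherryCover (M : Graph) (r : ℕ) (P : Finset Shape) : Prop :=
  (∀ A ∈ P, A.valid M) ∧
  (∀ e ∈ M, e.1 ≠ r → 1 ≤ covers P e) ∧
  (∀ e ∈ M, (2 ≤ indeg M e.1 ∧ 1 ≤ outdeg M e.1) → covers P e = M.count e) ∧
  (∀ e : ℕ × ℕ, (∃ A ∈ P, A.middleEdge = some e) → covers P e = 1)

/-- A cherry decomposition of `M` with root `r`: a set of valid shapes covering
each arc except the root arc exactly once (over parallel copies, exactly as often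
as its multiplicity). -/
def IsCherryDecomp (M : Graph) (r : ℕ) (P : Finset Shape) : Prop :=
  (∀ A ∈ P, A.valid M) ∧
  (∀ e ∈ M, e.1 ≠ r → covers P e = M.count e)

/-- `A` is directly above `B` when an internal vertex of `B` is an endpoint of `A`. -/
def DirectlyAbove (A B : Shape) : Prop := ∃ v ∈ B.internals, v ∈ A.endpoints

/-- `A` is above `B` (within `P`) when some nonempty chain of shapes of `P`, each
directly above the next, leads from `A` to `B`. -/
def Above (P : Finset Shape) : Shape → Shape → Prop :=
  Relation.TransGen (fun A B => A ∈ P ∧ B ∈ P ∧ DirectlyAbove A B)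

/-- A cherry cover is acyclic when no shape is above itself. -/
def AcyclicCover (P : Finset Shape) : Prop := ∀ A : Shape, ¬ Above P A A

/-- A lowest shape of `P`: one that is above no other shape of `P`. -/
def IsLowest (P : Finset Shape) (A : Shape) : Prop :=
  A ∈ P ∧ ∀ B ∈ P, B ≠ A → ¬ Above P A B

/-- `E` is a spanning (directed) tree of `M` rooted at `r`: a subset of the arcs,
on all vertices of `M`, acyclic, in which `r` has indegree 0 and every other
vertex indegree exactly 1. -/
def IsSpanningArborescence (M : Graph) (r : ℕ) (E : Graph) : Prop :=
  E ≤ M ∧ verts E = verts M ∧ Acyclic E ∧ indeg E r = 0 ∧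
    ∀ v ∈ verts E, v ≠ r → indeg E v = 1

/-- `M` has a spanning tree whose leaves are (bijectively labelled by) `L`. -/
def HasSpanningTreeWithLeaves (M : Graph) (L : Finset ℕ) : Prop :=
  ∃ r E, IsRoot M r ∧ IsSpanningArborescence M r E ∧
    ∀ v ∈ verts E, (outdeg E v = 0 ↔ v ∈ L)

/-- A network is tree-based when it has a base tree, i.e. a spanning tree whose
leaves are exactly the (labelled) leaves of the network. -/
def IsTreeBased (M : Graph) : Prop := HasSpanningTreeWithLeaves M (leaves M)

/-- Rename the vertex `a` to `b` in an arc. -/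
def rn (a b : ℕ) (e : ℕ × ℕ) : ℕ × ℕ :=
  (if e.1 = a then b else e.1, if e.2 = a then b else e.2)

/-- The parent of a vertex (an arbitrary in-neighbour; unique for leaves). -/
def parent (M : Graph) (v : ℕ) : ℕ :=
  if h : ∃ p, (p, v) ∈ M then h.choose else 0

/-- `(x,y)` is a cherry: two distinct leaves with a common parent. -/
def IsCherryPair (M : Graph) (x y : ℕ) : Prop :=
  x ≠ y ∧ IsLeaf M x ∧ IsLeaf M y ∧ ∃ p, (p, x) ∈ M ∧ (p, y) ∈ M

/-- `(x,y)` is a reticulated cherry: leaves `x, y` such that the parent of `x` is a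
reticulation that is a child of the parent of `y`. -/
def IsReticCherryPair (M : Graph) (x y : ℕ) : Prop :=
  x ≠ y ∧ IsLeaf M x ∧ IsLeaf M y ∧
    ∃ px py, IsRetic M px ∧ (px, x) ∈ M ∧ (py, px) ∈ M ∧ (py, y) ∈ M

/-- A reducible pair: a cherry or a reticulated cherry. -/
def ReduciblePair (M : Graph) (x y : ℕ) : Prop :=
  IsCherryPair M x y ∨ IsReticCherryPair M x y

/-- Reducing the ordered pair `(x,y)` in the network `M`: delete the edges of the
corresponding cherry shape or reticulated cherry shape, delete isolated vertices,
label unlabelled outdegree-0 vertices by the label of one of their children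
(formally: rename them to that child), and keep the leaf `y` below its parent when
that parent is a multifurcation.  If `(x,y)` is not reducible, do nothing. -/
def reducePair (M : Graph) (xy : ℕ × ℕ) : Graph :=
  let x := xy.1
  let y := xy.2
  if IsCherryPair M x y then
    let p := parent M y
    if outdeg M p = 2 then ((M.erase (p, x)).erase (p, y)).map (rn p y)
    else M.erase (p, x)
  else if IsReticCherryPair M x y then
    let px := parent M x
    let py := parent M y
    let M₁ := M.erase (py, px)
    let M₂ := if indeg M px = 2 then (M₁.erase (px, x)).map (rn px x) else M₁
    if outdeg M py = 2 then (M₂.erase (py, y)).map (rn py y) else M₂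
  else M

/-- Successively reduce the ordered pairs of a sequence. -/
def reduceSeq (M : Graph) : List (ℕ × ℕ) → Graph
  | [] => M
  | e :: S => reduceSeq (reducePair M e) S

/-- Orchard: some sequence of ordered pairs reduces the network to a network on a
single leaf. -/
def IsOrchard (M : Graph) : Prop :=
  ∃ S : List (ℕ × ℕ),
    IsNetwork (reduceSeq M S) ∧ (leaves (reduceSeq M S)).card = 1

/-- One edge contraction: delete an arc and identify its endpoints. -/
def ContractStep (M M' : Graph) : Prop :=
  ∃ e ∈ M, M' = (M.erase e).map (rn e.1 e.2)

/-- `M` can be turned into `M'` by (repeatedly) contracting edges. -/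
def ContractsTo : Graph → Graph → Prop := Relation.ReflTransGen ContractStep

end PhyloNet

namespace PhyloNet

def mlt (M : Graph) (e : ℕ × ℕ) : ℕ :=
  if 2 ≤ indeg M e.1 ∧ outdeg M e.1 = 1 then indeg M e.1 - 1 else 1

lemma mlt_pos (M : Graph) (e : ℕ × ℕ) : 1 ≤ mlt M e := by
  unfold mlt; split_ifs <;> omega

lemma bulged_eq (M : Graph) : bulged M = M.bind (fun e => Multiset.replicate (mlt M e) e) := rfl

lemma mem_bulged (M : Graph) (e : ℕ × ℕ) : e ∈ bulged M ↔ e ∈ M := by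
  rw [bulged_eq, Multiset.mem_bind]
  constructor
  · rintro ⟨a, ha, h⟩
    rw [Multiset.eq_of_mem_replicate h]; exact ha
  · intro h
    refine ⟨e, h, ?_⟩
    rw [Multiset.mem_replicate]
    exact ⟨by have := mlt_pos M e; omega, rfl⟩

lemma card_filter_bind (M : Graph) (f : ℕ × ℕ → ℕ) (p : ℕ × ℕ → Prop) [DecidablePred p] :
    Multiset.card ((M.bind (fun e => Multiset.replicate (f e) e)).filter p)
      = ((M.filter p).map f).sum := by
  induction M using Multiset.induction with
  | empty => simp
  | cons a s ih =>
    rw [Multiset.cons_bind, Multiset.filter_add, Multiset.card_add, ih]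
    by_cases h : p a
    · rw [Multiset.filter_cons_of_pos _ h, Multiset.filter_eq_self.2]
      · simp
      · intro b hb; rw [Multiset.eq_of_mem_replicate hb]; exact h
    · rw [Multiset.filter_cons_of_neg _ h, Multiset.filter_eq_nil.2]
      · simp
      · intro b hb; rw [Multiset.eq_of_mem_replicate hb]; exact h

lemma count_bulged (M : Graph) (hM : Simple M) (e : ℕ × ℕ) (he : e ∈ M) :
    (bulged M).count e = mlt M e := by
  have h1 : M.count e = 1 := le_antisymm (hM e) (Multiset.one_le_count_iff_mem.2 he)
  rw [Multiset.count_eq_card_filter_eq, bulged_eq, card_filter_bind,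
    Multiset.filter_eq, h1]
  simp

lemma out_one {M : Graph} {v a b : ℕ} (h : outdeg M v = 1) (ha : (v, a) ∈ M)
    (hb : (v, b) ∈ M) : a = b := by
  unfold outdeg at h
  obtain ⟨e, he⟩ := Multiset.card_eq_one.1 h
  have h1 : (v, a) ∈ M.filter (fun e => e.1 = v) := by simp [ha]
  have h2 : (v, b) ∈ M.filter (fun e => e.1 = v) := by simp [hb]
  rw [he, Multiset.mem_singleton] at h1 h2
  have := h1.trans h2.symm
  simpa using this

lemma out_two {M : Graph} {v a b c : ℕ} (h : outdeg M v = 2) (ha : (v, a) ∈ M)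
    (hb : (v, b) ∈ M) (hab : a ≠ b) (hc : (v, c) ∈ M) : c = a ∨ c = b := by
  unfold outdeg at h
  obtain ⟨e, f, he⟩ := Multiset.card_eq_two.1 h
  have h1 : (v, a) ∈ M.filter (fun e => e.1 = v) := by simp [ha]
  have h2 : (v, b) ∈ M.filter (fun e => e.1 = v) := by simp [hb]
  have h3 : (v, c) ∈ M.filter (fun e => e.1 = v) := by simp [hc]
  rw [he] at h1 h2 h3
  simp only [Multiset.insert_eq_cons, Multiset.mem_cons, Multiset.mem_singleton] at h1 h2 h3
  grind

lemma exists_out {M : Graph} {v : ℕ} (h : 1 ≤ outdeg M v) : ∃ a, (v, a) ∈ M := by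
  unfold outdeg at h
  obtain ⟨e, he⟩ := Multiset.card_pos_iff_exists_mem.1 h
  rw [Multiset.mem_filter] at he
  exact ⟨e.2, by rw [← he.2]; exact he.1⟩

lemma mem_verts_left {M : Graph} {u v : ℕ} (h : (u, v) ∈ M) : u ∈ verts M := by
  unfold verts
  rw [Finset.mem_union, Finset.mem_image]
  exact Or.inl ⟨(u, v), by simpa using h, rfl⟩

lemma mem_verts_right {M : Graph} {u v : ℕ} (h : (u, v) ∈ M) : v ∈ verts M := by
  unfold verts
  rw [Finset.mem_union, Finset.mem_image, Finset.mem_image]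
  exact Or.inr ⟨(u, v), by simpa using h, rfl⟩

lemma sum_card_filter (M : Graph) (g : ℕ × ℕ → ℕ) (S : Finset ℕ) (h : ∀ e ∈ M, g e ∈ S) :
    ∑ v ∈ S, Multiset.card (M.filter (fun e => g e = v)) = Multiset.card M := by
  induction M using Multiset.induction with
  | empty => simp
  | cons a s ih =>
    rw [Multiset.card_cons, ← ih (fun e he => h e (Multiset.mem_cons_of_mem he))]
    have : ∀ v, Multiset.card ((a ::ₘ s).filter (fun e => g e = v))
        = Multiset.card (s.filter (fun e => g e = v)) + if g a = v then 1 else 0 := by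
      intro v
      rw [Multiset.filter_cons]
      split_ifs <;> simp [add_comm]
    simp only [this, Finset.sum_add_distrib]
    rw [Finset.sum_ite_eq, if_pos (h a (Multiset.mem_cons_self a s))]

lemma handshake (M : Graph) : ∑ v ∈ verts M, indeg M v = ∑ v ∈ verts M, outdeg M v := by
  unfold indeg outdeg
  rw [sum_card_filter M Prod.snd, sum_card_filter M Prod.fst]
  · exact fun e he => mem_verts_left (u := e.1) (v := e.2) he
  · exact fun e he => mem_verts_right (u := e.1) (v := e.2) he

/-- The top internal vertex. -/
def top : Shape → ℕ
  | .cherry _ _ p => p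
  | .retic _ _ _ py => py

/-- The reticulation (junk on cherries). -/
def bot : Shape → ℕ
  | .cherry _ _ p => p
  | .retic _ _ px _ => px

lemma count_id (N : Graph) (r : ℕ) (hN : IsNetwork N) (hsb : IsSemiBinary N) (hr : IsRoot N r) :
    (leaves N).card + reticNumber N
      = 1 + ((verts N).filter (fun v => IsTreeVertex N v)).card := by
  obtain ⟨-, -, hu, hc⟩ := hN
  have h := handshake N
  have key : ∑ v ∈ verts N, (indeg N v + (if v = r then 1 else 0)
        + (if IsTreeVertex N v then 1 else 0))
      = ∑ v ∈ verts N, (outdeg N v + (if indeg N v = 1 ∧ outdeg N v = 0 then 1 else 0)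
        + (if 2 ≤ indeg N v then indeg N v - 1 else 0)) := by
    refine Finset.sum_congr rfl fun v hv => ?_
    by_cases hvr : v = r
    · subst hvr
      obtain ⟨h1, h2, h3⟩ := hr
      simp [IsTreeVertex, h2, h3]
    · rcases hc v hv with h | h | h | h
      · exact absurd (hu.unique h hr) hvr
      · obtain ⟨-, h2, h3⟩ := h
        simp [IsTreeVertex, h2, h3, hvr]
      · have := hsb v h
        obtain ⟨h1, h2, h3⟩ := id h
        simp only [h, hvr, if_true, if_false, h2]
        have : outdeg N v = 2 := by omega
        simp [this]
      · obtain ⟨-, h2, h3⟩ := h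
        simp only [IsTreeVertex, hvr, if_false, h3, h2, if_true]
        simp
        omega
  simp only [Finset.sum_add_distrib] at key
  rw [Finset.sum_ite_eq' (verts N) r, if_pos hr.1] at key
  unfold leaves reticNumber
  rw [Finset.card_filter, Finset.card_filter, Finset.sum_filter]
  omega

lemma cherry_facts (N : Graph) (r : ℕ) (hN : IsNetwork N)
    {v x y : ℕ} (hxy : x ≠ y) (hx : (v, x) ∈ N) (hy : (v, y) ∈ N) : IsTreeVertex N v := by
  have : outdeg N v ≠ 1 := fun h => hxy (out_one h hx hy)
  have h0 : outdeg N v ≠ 0 := by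
    intro h
    unfold outdeg at h
    rw [Multiset.card_eq_zero] at h
    have h1 : (v, x) ∈ N.filter (fun e => e.1 = v) := by simp [hx]
    rw [h] at h1; simp at h1
  rcases hN.2.2.2 v (mem_verts_left hx) with h | h | h | h
  · exact absurd h.2.2 this
  · exact absurd h.2.2 h0
  · exact h
  · exact absurd h.2.2 this

lemma retic_facts (N : Graph) (r : ℕ) (hN : IsNetwork N)
    {px py : ℕ} (ht : IsTreeVertex N py) (he : (py, px) ∈ N)
    (hi : 2 ≤ indeg (bulged N) px) (ho : 1 ≤ outdeg (bulged N) px) : IsRetic N px := by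
  have hm : mlt N (py, px) = 1 := by
    unfold mlt; rw [if_neg]; have := ht.2.2; simp; omega
  have h1 : indeg N px ≠ 1 := by
    intro h
    unfold indeg at h
    obtain ⟨e, h⟩ := Multiset.card_eq_one.1 h
    have h1 : (py, px) ∈ N.filter (fun e => e.2 = px) := by simp [he]
    unfold indeg at hi
    rw [h, Multiset.mem_singleton] at h1
    rw [bulged_eq, card_filter_bind, h, ← h1] at hi
    simp [hm] at hi
  have h0 : indeg N px ≠ 0 := by
    intro h
    unfold indeg at h
    rw [Multiset.card_eq_zero] at h
    have h1 : (py, px) ∈ N.filter (fun e => e.2 = px) := by simp [he]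
    rw [h] at h1; simp at h1
  rcases hN.2.2.2 px (mem_verts_right he) with h | h | h | h
  · exact absurd h.2.1 h0
  · exact absurd h.2.1 h1
  · exact absurd h.2.1 h1
  · exact h

/-- **Theorem (statement 6).** A cherry decomposition of the bulged version of a
semi-binary network with `n` leaves and reticulation number `r` contains exactly
`n - 1` cherry shapes and exactly `r` reticulated cherry shapes. -/
theorem semiBinary_cherryDecomp_counts (N : Graph) (r : ℕ)
    (hN : IsNetwork N) (hsb : IsSemiBinary N) (hr : IsRoot N r)
    (P : Finset Shape) (hP : IsCherryDecomp (bulged N) r P) :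
    (P.filter (fun A => A.isCherry = true)).card = (leaves N).card - 1 ∧
    (P.filter (fun A => A.isCherry = false)).card = reticNumber N := by
  have hid := count_id N r hN hsb hr
  obtain ⟨hval, hcov⟩ := hP
  simp only [mem_bulged] at hcov
  have hout : ∀ v, IsTreeVertex N v → outdeg N v = 2 := by
    intro v h; have := hsb v h; have := h.2.1; have := h.2.2; omega
  have htr : ∀ v, IsTreeVertex N v → ¬ IsRetic N v := by
    intro v h h'; have := h.2.2; have := h'.2.2; omega
  have hC : ∀ x y p, Shape.cherry x y p ∈ P →
      x ≠ y ∧ (p, x) ∈ N ∧ (p, y) ∈ N ∧ IsTreeVertex N p := by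
    intro x y p h
    obtain ⟨h1, -, -, h2, h3⟩ := hval _ h
    rw [mem_bulged] at h2 h3
    exact ⟨h1, h2, h3, cherry_facts N r hN h1 h2 h3⟩
  have hR : ∀ x y px py, Shape.retic x y px py ∈ P →
      y ≠ px ∧ (px, x) ∈ N ∧ (py, px) ∈ N ∧ (py, y) ∈ N ∧ IsTreeVertex N py ∧ IsRetic N px := by
    intro x y px py h
    obtain ⟨-, -, -, h1, -, -, h2, h3, h4, h5, h6⟩ := hval _ h
    rw [mem_bulged] at h2 h3 h4
    have ht := cherry_facts N r hN h1 h4 h3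
    exact ⟨h1, h2, h3, h4, ht, retic_facts N r hN ht h3 h5 h6⟩
  have hT : P.card = ((verts N).filter (fun v => IsTreeVertex N v)).card := by
    rw [Finset.card_eq_sum_card_fiberwise (f := top)
      (t := (verts N).filter (fun v => IsTreeVertex N v)), Finset.card_eq_sum_ones]
    · refine Finset.sum_congr rfl fun t ht => ?_
      have ht := (Finset.mem_filter.1 ht).2
      obtain ⟨a, ha⟩ := exists_out (M := N) (v := t) (by have := ht.2.2; omega)
      have htr' : t ≠ r := by
        rintro rfl; have := ht.2.1; have := hr.2.1; omega
      have h1 := hcov (t, a) ha htr'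
      rw [count_bulged N hN.1 _ ha] at h1
      have hm : mlt N (t, a) = 1 := by
        unfold mlt; rw [if_neg]; have := ht.2.2; simp; omega
      rw [hm] at h1
      rw [← h1]
      unfold covers
      congr 1
      refine Finset.filter_congr fun A hA => ?_
      cases A with
      | cherry x y p =>
        obtain ⟨hne, h2, h3, h4⟩ := hC _ _ _ hA
        simp only [top, Shape.edges, Finset.mem_insert, Finset.mem_singleton, Prod.mk.injEq]
        constructor
        · rintro rfl
          have := out_two (hout _ ht) h2 h3 hne ha
          tauto
        · rintro (h | h) <;> exact h.1.symm
      | retic x y px py =>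
        obtain ⟨hne, h2, h3, h4, h5, h6⟩ := hR _ _ _ _ hA
        simp only [top, Shape.edges, Finset.mem_insert, Finset.mem_singleton, Prod.mk.injEq]
        constructor
        · rintro rfl
          have := out_two (hout _ ht) h4 h3 hne ha
          tauto
        · rintro (h | h | h)
          · exact absurd (h.1 ▸ h6) (htr _ ht)
          · exact h.1.symm
          · exact h.1.symm
    · intro A hA
      have hA : A ∈ P := hA
      rw [Finset.mem_coe, Finset.mem_filter]
      cases A with
      | cherry x y p =>
        obtain ⟨hne, h2, h3, h4⟩ := hC _ _ _ hA
        exact ⟨h4.1, h4⟩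
      | retic x y px py =>
        obtain ⟨hne, h2, h3, h4, h5, h6⟩ := hR _ _ _ _ hA
        exact ⟨h5.1, h5⟩
  have hRet : (P.filter (fun A => A.isCherry = false)).card = reticNumber N := by
    unfold reticNumber
    rw [Finset.card_eq_sum_card_fiberwise (f := bot)
      (t := (verts N).filter (fun v => 2 ≤ indeg N v))]
    · refine Finset.sum_congr rfl fun t ht => ?_
      obtain ⟨hv, hi⟩ := Finset.mem_filter.1 ht
      have htr' : t ≠ r := by
        rintro rfl; have := hr.2.1; omega
      have ht : IsRetic N t := by
        rcases hN.2.2.2 t hv with h | h | h | h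
        · have := h.2.1; omega
        · have := h.2.1; omega
        · have := h.2.1; omega
        · exact h
      obtain ⟨a, ha⟩ := exists_out (M := N) (v := t) (by have := ht.2.2; omega)
      have h1 := hcov (t, a) ha htr'
      rw [count_bulged N hN.1 _ ha] at h1
      have hm : mlt N (t, a) = indeg N t - 1 := by
        unfold mlt; rw [if_pos]; exact ⟨hi, ht.2.2⟩
      rw [hm] at h1
      rw [← h1]
      unfold covers
      rw [Finset.filter_filter]
      congr 1
      refine Finset.filter_congr fun A hA => ?_
      cases A with
      | cherry x y p =>
        obtain ⟨hne, h2, h3, h4⟩ := hC _ _ _ hA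
        simp only [Shape.isCherry, Shape.edges, Finset.mem_insert, Finset.mem_singleton,
          Prod.mk.injEq]
        constructor
        · intro h; simp at h
        · rintro (h | h) <;> exact absurd (h.1 ▸ ht) (htr _ h4)
      | retic x y px py =>
        obtain ⟨hne, h2, h3, h4, h5, h6⟩ := hR _ _ _ _ hA
        simp only [bot, Shape.isCherry, Shape.edges, Finset.mem_insert, Finset.mem_singleton,
          Prod.mk.injEq, true_and]
        constructor
        · rintro rfl
          exact Or.inl ⟨rfl, out_one ht.2.2 ha h2⟩
        · rintro (h | h | h)
          · exact h.1.symm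
          · exact absurd (h.1 ▸ ht) (htr _ h5)
          · exact absurd (h.1 ▸ ht) (htr _ h5)
    · intro A hA
      rw [Finset.mem_coe, Finset.mem_filter] at hA ⊢
      obtain ⟨hA, hf⟩ := hA
      cases A with
      | cherry x y p => simp [Shape.isCherry] at hf
      | retic x y px py =>
        obtain ⟨hne, h2, h3, h4, h5, h6⟩ := hR _ _ _ _ hA
        exact ⟨h6.1, h6.2.1⟩
  refine ⟨?_, hRet⟩
  have hs := Finset.card_filter_add_card_filter_not (s := P) (fun A => A.isCherry = true)
  simp only [Bool.not_eq_true] at hs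
  omega

end PhyloNet
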